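/- Let ψ : ℝ → ℝ be a smooth odd function supported in {1/4 ≤ |x| ≤ 1} such that Σ_{k≥0} 2^{-k}ψ(2^{-k}t) = 1/t for all |t| ≥ 1. Then the function φ(u) = ψ(u^{1/3})/u^{2/3} (extended oddly to u < 0) satisfies: Σ_{k≥0} 2^{-k}φ(2^{-k}u)·(appropriately scaled) recovers a kernel K with |u·K(u)| bounded; concretely, H^s(β) := Σ_{j ≥ s/ε} ∫_ℝ e(-2πiβt³)ψ_j(t) dt = (1/3)Σ_{j≥s/ε} ∫_ℝ e(-2πiβu) ψ_j(u^{1/3}) u^{-2/3} du (odd extension), and the inverse Fourier transform of H^s is a Calderón–Zygmund kernel: it satisfies sup_{x≠0} (|x·Ȟ^s(x)| + |x²·(d/dx)Ȟ^s(x)|) ≲ 1 uniformly in s, and Ȟ^s(x) = 0 for |x| ≤ 2^{3(s/ε - 2)}. -/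

import Mathlib

/-- The dilated bump `ψ_j(x) = 2^{-j} ψ(2^{-j} x)`. -/
noncomputable def psij (ψ : ℝ → ℝ) (j : ℕ) (x : ℝ) : ℝ :=
  (2 : ℝ) ^ (-(j : ℝ)) * ψ ((2 : ℝ) ^ (-(j : ℝ)) * x)

/-- The oscillatory integral `H_j(y) = ∫ e(-y t³) ψ_j(t) dt`. -/
noncomputable def Hj (ψ : ℝ → ℝ) (j : ℕ) (y : ℝ) : ℂ :=
  ∫ t : ℝ, Complex.exp (-(2 * (Real.pi : ℂ) * Complex.I) * (y : ℂ) * (t : ℂ) ^ 3) *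
    (psij ψ j t : ℂ)

/-- The odd extension of `u ↦ ψ_j(u^{1/3}) u^{-2/3}` to all of `ℝ`. -/
noncomputable def oddext (ψ : ℝ → ℝ) (j : ℕ) (u : ℝ) : ℝ :=
  if 0 < u then psij ψ j (u ^ ((1 : ℝ) / 3)) / u ^ ((2 : ℝ) / 3)
  else if u < 0 then -(psij ψ j ((-u) ^ ((1 : ℝ) / 3)) / (-u) ^ ((2 : ℝ) / 3))
  else 0

/-- The multiplier `H^s(β) = Σ_{j ≥ s/ε} H_j(β)`. -/
noncomputable def Hs (ψ : ℝ → ℝ) (ε : ℝ) (s : ℕ) (β : ℝ) : ℂ :=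
  ∑' j : ℕ, if (s : ℝ) / ε ≤ (j : ℝ) then Hj ψ j β else 0

/-- The inverse Fourier transform `Ȟ^s` of `H^s` on `ℝ`. -/
noncomputable def HsInv (ψ : ℝ → ℝ) (ε : ℝ) (s : ℕ) (x : ℝ) : ℂ :=
  ∫ β : ℝ, Hs ψ ε s β * Complex.exp (2 * (Real.pi : ℂ) * Complex.I * (β : ℂ) * (x : ℂ))

open MeasureTheory Set Filter Topology
open scoped FourierTransform

lemma psij_eq (ψ : ℝ → ℝ) (j : ℕ) (x : ℝ) :
    psij ψ j x = ((2:ℝ)^j)⁻¹ * ψ (((2:ℝ)^j)⁻¹ * x) := by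
  unfold psij
  rw [Real.rpow_neg (by norm_num), Real.rpow_natCast]

lemma cube_bij : Function.Bijective (fun t : ℝ => t ^ 3) := by
  refine ⟨(Odd.strictMono_pow (by decide : Odd 3)).injective, ?_⟩
  refine (continuous_pow 3).surjective (tendsto_pow_atTop (by norm_num)) ?_
  have h : Tendsto (fun t : ℝ => (-t) ^ 3) atBot atTop :=
    (tendsto_pow_atTop (by norm_num)).comp tendsto_neg_atBot_atTop
  refine (tendsto_neg_atTop_atBot.comp h).congr fun t => ?_
  simp only [Function.comp]
  ring

lemma exists_cube (u : ℝ) : ∃ t : ℝ, t ^ 3 = u := cube_bij.surjective u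

lemma oddext_cube (ψ : ℝ → ℝ) (hodd : ∀ x, ψ (-x) = -ψ x) (j : ℕ) (t : ℝ) :
    oddext ψ j (t ^ 3) = psij ψ j t / t ^ 2 := by
  have key : ∀ t : ℝ, 0 < t → (t ^ 3) ^ ((1:ℝ)/3) = t ∧ (t ^ 3) ^ ((2:ℝ)/3) = t ^ 2 := by
    intro t ht
    constructor
    · rw [← Real.rpow_natCast, ← Real.rpow_mul ht.le]; norm_num
    · rw [← Real.rpow_natCast, ← Real.rpow_mul ht.le, ← Real.rpow_natCast]; norm_num
  have hps : psij ψ j (-t) = - psij ψ j t := by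
    simp only [psij_eq, mul_neg, hodd]
  unfold oddext
  rcases lt_trichotomy t 0 with ht | ht | ht
  · have h3 : t ^ 3 < 0 := Odd.pow_neg (by decide) ht
    rw [if_neg (not_lt.2 h3.le), if_pos h3]
    have e : -(t ^ 3) = (-t) ^ 3 := by ring
    rw [e, (key (-t) (by linarith)).1, (key (-t) (by linarith)).2, hps]
    rw [neg_div, neg_neg, neg_sq]
  · subst ht; simp
  · have h3 : 0 < t ^ 3 := by positivity
    rw [if_pos h3, (key t ht).1, (key t ht).2]

lemma oddext_scale (ψ : ℝ → ℝ) (hodd : ∀ x, ψ (-x) = -ψ x) (j : ℕ) (u : ℝ) :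
    oddext ψ j u = ((8:ℝ)^j)⁻¹ * oddext ψ 0 (((8:ℝ)^j)⁻¹ * u) := by
  obtain ⟨t, rfl⟩ := exists_cube u
  have e : ((8:ℝ)^j)⁻¹ = (((2:ℝ)^j)⁻¹) ^ 3 := by
    rw [inv_pow, ← pow_mul, mul_comm, pow_mul]; norm_num
  rw [e, ← mul_pow, oddext_cube ψ hodd, oddext_cube ψ hodd, psij_eq, psij_eq]
  have h2 : (2:ℝ)^j ≠ 0 := by positivity
  generalize (2:ℝ)^j = a at *
  by_cases ht : t = 0
  · subst ht; simp
  · simp only [pow_zero, inv_one, one_mul]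
    field_simp

lemma psi_strict (ψ : ℝ → ℝ) (hc : Continuous ψ)
    (hsupp : ∀ x, ψ x ≠ 0 → 1 / 4 ≤ |x| ∧ |x| ≤ 1) (x : ℝ) (hx : ψ x ≠ 0) : 1 / 4 < |x| := by
  refine lt_of_le_of_ne (hsupp x hx).1 fun h => ?_
  have hev : ∀ᶠ y in 𝓝 x, ψ y ≠ 0 := hc.continuousAt.eventually_ne hx
  have ht : Tendsto (fun r : ℝ => r * x) (𝓝[<] 1) (𝓝 x) := by
    have : Tendsto (fun r : ℝ => r * x) (𝓝 1) (𝓝 (1 * x)) :=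
      (continuous_id.mul continuous_const).tendsto 1
    rw [one_mul] at this
    exact this.mono_left nhdsWithin_le_nhds
  have h1 := ht.eventually hev
  have h2 : ∀ᶠ r : ℝ in 𝓝[<] 1, r < 1 := self_mem_nhdsWithin
  have h3 : ∀ᶠ r : ℝ in 𝓝[<] 1, 0 < r :=
    nhdsWithin_le_nhds (lt_mem_nhds one_pos)
  obtain ⟨r, hr1, hr2, hr3⟩ := (h1.and (h2.and h3)).exists
  have := (hsupp _ hr1).1
  rw [abs_mul, ← h, abs_of_pos hr3] at this
  linarith

lemma phi_supp (ψ : ℝ → ℝ) (hc : Continuous ψ) (hodd : ∀ x, ψ (-x) = -ψ x)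
    (hsupp : ∀ x, ψ x ≠ 0 → 1 / 4 ≤ |x| ∧ |x| ≤ 1) (u : ℝ) (hu : oddext ψ 0 u ≠ 0) :
    1 / 64 < |u| ∧ |u| ≤ 1 := by
  obtain ⟨t, rfl⟩ := exists_cube u
  rw [oddext_cube ψ hodd, psij_eq] at hu
  have h : ψ t ≠ 0 := by
    intro h; apply hu; simp [h]
  have h1 := psi_strict ψ hc hsupp t h
  have h2 := (hsupp t h).2
  rw [abs_pow]
  refine ⟨?_, pow_le_one₀ (abs_nonneg _) h2⟩
  calc (1/64:ℝ) = (1/4)^3 := by norm_num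
    _ < _ := by gcongr

lemma phi_smooth (ψ : ℝ → ℝ) (hsmooth : ContDiff ℝ (⊤ : ℕ∞) ψ) (hodd : ∀ x, ψ (-x) = -ψ x)
    (hsupp : ∀ x, ψ x ≠ 0 → 1 / 4 ≤ |x| ∧ |x| ≤ 1) :
    ContDiff ℝ (⊤ : ℕ∞) (oddext ψ 0) := by
  have hneg : ∀ u, oddext ψ 0 u = - oddext ψ 0 (-u) := by
    intro u
    obtain ⟨t, rfl⟩ := exists_cube u
    have e : -(t ^ 3) = (-t) ^ 3 := by ring
    rw [e, oddext_cube ψ hodd, oddext_cube ψ hodd]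
    simp [psij_eq, hodd, neg_div]
  have hpos : ∀ u : ℝ, 0 < u → ContDiffAt ℝ (⊤ : ℕ∞) (oddext ψ 0) u := by
    intro u hu
    have h1 : ContDiffAt ℝ (⊤ : ℕ∞)
        (fun u : ℝ => ψ (u ^ ((1 : ℝ) / 3)) / u ^ ((2 : ℝ) / 3)) u := by
      refine ContDiffAt.div ?_ (Real.contDiffAt_rpow_const_of_ne hu.ne') (by positivity)
      exact hsmooth.contDiffAt.comp u (Real.contDiffAt_rpow_const_of_ne hu.ne')
    refine h1.congr_of_eventuallyEq ?_
    filter_upwards [lt_mem_nhds hu] with y hy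
    simp [oddext, hy, psij_eq]
  rw [contDiff_iff_contDiffAt]
  intro u
  rcases lt_trichotomy u 0 with hu | hu | hu
  · have h := (hpos (-u) (by linarith)).comp u contDiff_neg.contDiffAt
    have h := h.neg
    refine h.congr_of_eventuallyEq (Eventually.of_forall fun y => ?_)
    simpa using hneg y
  · subst hu
    refine (contDiffAt_const (c := (0:ℝ))).congr_of_eventuallyEq ?_
    have : ∀ᶠ y : ℝ in 𝓝 0, |y| < 1/64 := by
      have := Metric.ball_mem_nhds (0:ℝ) (by norm_num : (0:ℝ) < 1/64)
      filter_upwards [this] with y hy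
      simpa using hy
    filter_upwards [this] with y hy
    by_contra h
    exact absurd (phi_supp ψ hsmooth.continuous hodd hsupp y h).1 (not_lt.2 hy.le)
  · exact hpos u hu

lemma Hj_eq (ψ : ℝ → ℝ) (hodd : ∀ x, ψ (-x) = -ψ x) (j : ℕ) (β : ℝ) :
    Hj ψ j β = (1/3) * ∫ u : ℝ, Complex.exp (-(2 * (Real.pi : ℂ) * Complex.I) * (β : ℂ) * (u : ℂ)) *
            (oddext ψ j u : ℂ) := by
  have hb := cube_bij
  have h := integral_image_eq_integral_abs_deriv_smul (s := univ) (f := fun t : ℝ => t ^ 3)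
    (f' := fun t => 3 * t ^ 2) MeasurableSet.univ
    (fun x _ => by
      have h := hasDerivAt_pow 3 x
      norm_num at h
      exact h.hasDerivWithinAt)
    hb.injective.injOn
    (fun u : ℝ => Complex.exp (-(2 * (Real.pi : ℂ) * Complex.I) * (β : ℂ) * (u : ℂ)) *
            (oddext ψ j u : ℂ))
  rw [image_univ, hb.surjective.range_eq] at h
  simp only [Measure.restrict_univ] at h
  rw [h, Hj, ← integral_const_mul]
  congr 1
  ext t
  rw [oddext_cube ψ hodd, abs_of_nonneg (by positivity)]
  have h0 : t = 0 → psij ψ j t = 0 := by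
    rintro rfl
    have := hodd 0
    rw [neg_zero] at this
    have h0 : ψ 0 = 0 := by linarith
    simp [psij_eq, h0]
  by_cases ht : t = 0
  · rw [h0 ht]; simp
  · have : (t:ℂ) ≠ 0 := by exact_mod_cast ht
    rw [Complex.real_smul]
    push_cast
    field_simp

lemma count_bound (S : Finset ℕ) (f : ℕ → ℂ) (M x : ℝ) (hM : ∀ j, ‖f j‖ ≤ M)
    (hf : ∀ j, f j ≠ 0 → 1/64 ≤ |((8:ℝ)^j)⁻¹ * x| ∧ |((8:ℝ)^j)⁻¹ * x| ≤ 1) :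
    ‖∑ j ∈ S, f j‖ ≤ 3 * M := by
  classical
  have hM0 : 0 ≤ M := (norm_nonneg _).trans (hM 0)
  by_cases hne : ∃ j, f j ≠ 0
  · have hsub : ∀ j, f j ≠ 0 → j ∈ Finset.Icc (Nat.find hne) (Nat.find hne + 2) := by
      intro j hj
      rw [Finset.mem_Icc]
      refine ⟨Nat.find_min' hne hj, ?_⟩
      have h1 := (hf _ (Nat.find_spec hne)).2
      have h2 := (hf j hj).1
      rw [abs_mul, abs_of_pos (by positivity), inv_mul_le_iff₀ (by positivity)] at h1
      rw [abs_mul, abs_of_pos (by positivity), le_inv_mul_iff₀ (by positivity)] at h2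
      have h3 : (8:ℝ)^j ≤ 8 ^ (Nat.find hne + 2) := by
        rw [pow_add]; linarith
      exact (pow_le_pow_iff_right₀ (by norm_num)).1 h3
    calc ‖∑ j ∈ S, f j‖ = ‖∑ j ∈ S with f j ≠ 0, f j‖ := by rw [Finset.sum_filter_ne_zero]
      _ ≤ ∑ j ∈ S with f j ≠ 0, M := norm_sum_le_of_le _ fun j _ => hM j
      _ = ((S.filter fun j => f j ≠ 0).card : ℝ) * M := by simp
      _ ≤ 3 * M := by
        gcongr
        have : (S.filter fun j => f j ≠ 0).card ≤ (Finset.Icc (Nat.find hne) (Nat.find hne + 2)).card :=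
          Finset.card_le_card fun j hj => hsub j (Finset.mem_filter.1 hj).2
        rw [Nat.card_Icc] at this
        have : (S.filter fun j => f j ≠ 0).card ≤ 3 := by omega
        exact_mod_cast this
  · push Not at hne
    simp [hne]; positivity

/-- The complex-valued bump. -/
noncomputable def Phi (ψ : ℝ → ℝ) (u : ℝ) : ℂ := (oddext ψ 0 u : ℂ)

lemma Hj_fourier (ψ : ℝ → ℝ) (hodd : ∀ x, ψ (-x) = -ψ x) (j : ℕ) (β : ℝ) :
    Hj ψ j β = (1/3) * 𝓕 (Phi ψ) ((8:ℝ)^j * β) := by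
  rw [Hj_eq ψ hodd, Real.fourier_real_eq_integral_exp_smul]
  congr 1
  have h8 : (0:ℝ) < ((8:ℝ)^j)⁻¹ := by positivity
  have h := Measure.integral_comp_mul_left
    (fun v : ℝ => Complex.exp (↑(-2 * Real.pi * v * ((8:ℝ)^j * β)) * Complex.I) • Phi ψ v)
    (((8:ℝ)^j)⁻¹)
  rw [inv_inv, abs_of_pos (by positivity : (0:ℝ) < 8 ^ j), Complex.real_smul,
    ← inv_mul_eq_iff_eq_mul₀
      (by exact_mod_cast (by positivity : (8:ℝ)^j ≠ 0))] at h
  rw [← h, ← integral_const_mul]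
  congr 1
  ext u
  rw [oddext_scale ψ hodd, smul_eq_mul, Phi]
  have : -2 * Real.pi * (((8:ℝ)^j)⁻¹ * u) * (8 ^ j * β) = -2 * Real.pi * u * β := by
    field_simp
  rw [this]
  have e : (↑(-2 * Real.pi * u * β) * Complex.I : ℂ) = -(2 * (Real.pi : ℂ) * Complex.I) * (β : ℂ) * (u : ℂ) := by
    push_cast; ring
  rw [e]
  push_cast; ring

lemma Phi_facts (ψ : ℝ → ℝ) (hsmooth : ContDiff ℝ (⊤ : ℕ∞) ψ) (hodd : ∀ x, ψ (-x) = -ψ x)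
    (hsupp : ∀ x, ψ x ≠ 0 → 1 / 4 ≤ |x| ∧ |x| ≤ 1) :
    ContDiff ℝ (⊤ : ℕ∞) (Phi ψ) ∧ HasCompactSupport (Phi ψ) ∧ Integrable (𝓕 (Phi ψ)) ∧
    ∀ x : ℝ, ∫ β : ℝ, 𝓕 (Phi ψ) β * Complex.exp (2 * (Real.pi : ℂ) * Complex.I * (β : ℂ) * (x : ℂ)) = Phi ψ x := by
  have h1 : ContDiff ℝ (⊤ : ℕ∞) (Phi ψ) :=
    Complex.ofRealCLM.contDiff.comp (phi_smooth ψ hsmooth hodd hsupp)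
  have h2 : HasCompactSupport (Phi ψ) := by
    refine HasCompactSupport.of_support_subset_isCompact (isCompact_Icc (a := (-1:ℝ)) (b := 1)) ?_
    intro u hu
    have : oddext ψ 0 u ≠ 0 := by
      intro h; apply hu; simp [Phi, h]
    exact abs_le.1 (phi_supp ψ hsmooth.continuous hodd hsupp u this).2
  have h3 : Integrable (𝓕 (Phi ψ)) := by
    have := (𝓕 (h2.toSchwartzMap h1)).integrable (μ := volume)
    rwa [SchwartzMap.fourier_coe] at this
  refine ⟨h1, h2, h3, fun x => ?_⟩
  have h4 := congrFun (h1.continuous.fourierInv_fourier_eq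
    (h1.continuous.integrable_of_hasCompactSupport h2) h3) x
  rw [Real.fourierInv_eq_fourier_neg, Real.fourier_real_eq_integral_exp_smul] at h4
  rw [← h4]
  congr 1
  ext β
  rw [smul_eq_mul, mul_comm]
  congr 2
  push_cast; ring

lemma HsInv_eq (ψ : ℝ → ℝ) (hsmooth : ContDiff ℝ (⊤ : ℕ∞) ψ) (hodd : ∀ x, ψ (-x) = -ψ x)
    (hsupp : ∀ x, ψ x ≠ 0 → 1 / 4 ≤ |x| ∧ |x| ≤ 1) (ε : ℝ) (s : ℕ) (x : ℝ) :
    HsInv ψ ε s x = ∑' j : ℕ, if (s : ℝ) / ε ≤ (j : ℝ) then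
      (1/3) * (((8:ℂ)^j)⁻¹ * Phi ψ (((8:ℝ)^j)⁻¹ * x)) else 0 := by
  obtain ⟨-, -, h3, h4⟩ := Phi_facts ψ hsmooth hodd hsupp
  set F : ℕ → ℝ → ℂ := fun j β => if (s : ℝ) / ε ≤ (j : ℝ) then
    (1/3) * 𝓕 (Phi ψ) ((8:ℝ)^j * β) *
      Complex.exp (2 * (Real.pi : ℂ) * Complex.I * (β : ℂ) * (x : ℂ)) else 0 with hF
  have hnorm : ∀ β : ℝ, ‖Complex.exp (2 * (Real.pi : ℂ) * Complex.I * (β : ℂ) * (x : ℂ))‖ = 1 := by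
    intro β
    rw [show (2 * (Real.pi : ℂ) * Complex.I * (β : ℂ) * (x : ℂ)) = ((2 * Real.pi * β * x : ℝ) : ℂ) * Complex.I by
      push_cast; ring, Complex.norm_exp_ofReal_mul_I]
  have hint : ∀ j, Integrable (F j) := by
    intro j
    simp only [hF]
    split_ifs
    · have := ((h3.comp_mul_left' (R := (8:ℝ)^j) (by positivity)).const_mul (1/3:ℂ))
      refine this.mul_bdd (c := 1) (Continuous.aestronglyMeasurable (by fun_prop)) ?_
      exact Eventually.of_forall fun β => (hnorm β).le
    · exact integrable_zero _ _ _
  have hsumm : Summable fun j => ∫ β, ‖F j β‖ := by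
    have hg : Summable fun j : ℕ => (1/8:ℝ)^j * ((1/3) * ∫ β, ‖𝓕 (Phi ψ) β‖) :=
      (summable_geometric_of_lt_one (by norm_num) (by norm_num)).mul_right _
    refine Summable.of_nonneg_of_le (fun j => integral_nonneg fun β => norm_nonneg _) (fun j => ?_) hg
    simp only [hF]
    split_ifs
    · simp only [norm_mul, hnorm, mul_one]
      rw [integral_const_mul, Measure.integral_comp_mul_left (fun β => ‖𝓕 (Phi ψ) β‖)]
      rw [abs_of_pos (by positivity), smul_eq_mul]
      apply le_of_eq
      simp
      ring
    · simp; positivity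
  have h := hasSum_integral_of_summable_integral_norm hint hsumm
  have e1 : HsInv ψ ε s x = ∫ β, ∑' j, F j β := by
    unfold HsInv Hs
    congr 1
    ext β
    rw [← tsum_mul_right]
    congr 1
    ext j
    simp only [hF, Hj_fourier ψ hodd]
    split_ifs <;> simp
  rw [e1, ← h.tsum_eq]
  congr 1
  ext j
  simp only [hF]
  split_ifs
  · simp only [mul_assoc (1/3:ℂ)]
    rw [integral_const_mul]
    congr 1
    rw [← h4]
    have h := Measure.integral_comp_mul_left
      (fun β : ℝ => 𝓕 (Phi ψ) β * Complex.exp (2 * (Real.pi : ℂ) * Complex.I * (β : ℂ) * ((((8:ℝ)^j)⁻¹ * x : ℝ) : ℂ)))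
      ((8:ℝ)^j)
    rw [abs_of_pos (by positivity), Complex.real_smul] at h
    push_cast at h ⊢
    rw [← h]
    congr 1
    ext β
    congr 2
    field_simp
  · simp

theorem stmt_14 (ψ : ℝ → ℝ) (hsmooth : ContDiff ℝ (⊤ : ℕ∞) ψ) (hodd : ∀ x, ψ (-x) = -ψ x)
    (hsupp : ∀ x, ψ x ≠ 0 → 1 / 4 ≤ |x| ∧ |x| ≤ 1)
    (hsum : ∀ t : ℝ, 1 ≤ |t| →
      ∑' k : ℕ, (2 : ℝ) ^ (-(k : ℝ)) * ψ ((2 : ℝ) ^ (-(k : ℝ)) * t) = 1 / t)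
    (ε : ℝ) (hε : 0 < ε) :
    ∃ C > (0 : ℝ), ∀ s : ℕ, 1 ≤ s →
      (∀ β : ℝ, Hs ψ ε s β = (1 / 3) *
        ∑' j : ℕ, if (s : ℝ) / ε ≤ (j : ℝ) then
          (∫ u : ℝ, Complex.exp (-(2 * (Real.pi : ℂ) * Complex.I) * (β : ℂ) * (u : ℂ)) *
            (oddext ψ j u : ℂ)) else 0) ∧
      (∀ x : ℝ, x ≠ 0 →
        ‖(x : ℂ) * HsInv ψ ε s x‖ + ‖(x : ℂ) ^ 2 * deriv (HsInv ψ ε s) x‖ ≤ C) ∧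
      (∀ x : ℝ, |x| ≤ (2 : ℝ) ^ (3 * ((s : ℝ) / ε - 2)) → HsInv ψ ε s x = 0) := by
  obtain ⟨hP1, hP2, -, -⟩ := Phi_facts ψ hsmooth hodd hsupp
  have hPs : ∀ u, Phi ψ u ≠ 0 → 1/64 < |u| ∧ |u| ≤ 1 := by
    intro u hu
    refine phi_supp ψ hsmooth.continuous hodd hsupp u fun h => hu ?_
    simp [Phi, h]
  have hDs : ∀ u, deriv (Phi ψ) u ≠ 0 → 1/64 ≤ |u| ∧ |u| ≤ 1 := by
    intro u hu
    have hcl : IsClosed {u : ℝ | 1/64 ≤ |u| ∧ |u| ≤ 1} :=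
      (isClosed_le continuous_const continuous_abs).inter (isClosed_le continuous_abs continuous_const)
    have hsub : tsupport (Phi ψ) ⊆ {u : ℝ | 1/64 ≤ |u| ∧ |u| ≤ 1} :=
      closure_minimal (fun v hv => ⟨(hPs v hv).1.le, (hPs v hv).2⟩) hcl
    exact hsub (support_deriv_subset hu)
  obtain ⟨M, hM⟩ := hP2.exists_bound_of_continuous hP1.continuous
  obtain ⟨M', hM'⟩ := hP2.deriv.exists_bound_of_continuous (hP1.continuous_deriv (by simp))
  have hM0 : 0 ≤ M := (norm_nonneg _).trans (hM 0)
  have hM0' : 0 ≤ M' := (norm_nonneg _).trans (hM' 0)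
  have hdiff : Differentiable ℝ (Phi ψ) := hP1.differentiable (by simp)
  refine ⟨3 * M + 3 * M' + 1, by positivity, fun s _ => ⟨?_, ?_, ?_⟩⟩
  · intro β
    rw [Hs, ← tsum_mul_left]
    congr 1
    ext j
    split_ifs
    · exact Hj_eq ψ hodd j β
    · simp
  · intro x hx
    obtain ⟨N, hN⟩ := pow_unbounded_of_one_lt (64 * (|x| + 1)) (by norm_num : (1:ℝ) < 8)
    have hfin : ∀ y, |y| < |x| + 1 → HsInv ψ ε s y = ∑ j ∈ Finset.range N,
        if (s : ℝ) / ε ≤ (j : ℝ) then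
        (1/3) * (((8:ℂ)^j)⁻¹ * Phi ψ (((8:ℝ)^j)⁻¹ * y)) else 0 := by
      intro y hy
      rw [HsInv_eq ψ hsmooth hodd hsupp]
      refine tsum_eq_sum fun j hj => ?_
      have hj : N ≤ j := by simpa using hj
      have : Phi ψ (((8:ℝ)^j)⁻¹ * y) = 0 := by
        by_contra h
        have h1 := (hPs _ h).1
        rw [abs_mul, abs_of_pos (by positivity), lt_inv_mul_iff₀ (by positivity)] at h1
        have : (8:ℝ)^N ≤ 8^j := pow_le_pow_right₀ (by norm_num) hj
        linarith
      simp [this]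
    have hev : HsInv ψ ε s =ᶠ[𝓝 x] fun y => ∑ j ∈ Finset.range N,
        if (s : ℝ) / ε ≤ (j : ℝ) then
        (1/3) * (((8:ℂ)^j)⁻¹ * Phi ψ (((8:ℝ)^j)⁻¹ * y)) else 0 := by
      have : ∀ᶠ y in 𝓝 x, |y| < |x| + 1 :=
        continuous_abs.continuousAt.eventually_lt continuousAt_const (by linarith)
      filter_upwards [this] with y hy using hfin y hy
    have hder : HasDerivAt (fun y : ℝ => ∑ j ∈ Finset.range N,
        if (s : ℝ) / ε ≤ (j : ℝ) then
        (1/3) * (((8:ℂ)^j)⁻¹ * Phi ψ (((8:ℝ)^j)⁻¹ * y)) else 0)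
        (∑ j ∈ Finset.range N, if (s : ℝ) / ε ≤ (j : ℝ) then
        (1/3) * (((8:ℂ)^j)⁻¹ * (((8:ℂ)^j)⁻¹ * deriv (Phi ψ) (((8:ℝ)^j)⁻¹ * x))) else 0) x := by
      refine HasDerivAt.fun_sum fun j _ => ?_
      split_ifs
      · have h1 : HasDerivAt (fun y : ℝ => ((8:ℝ)^j)⁻¹ * y) (((8:ℝ)^j)⁻¹) x := by
          simpa using (hasDerivAt_id x).const_mul (((8:ℝ)^j)⁻¹)
        have h2 := (hdiff (((8:ℝ)^j)⁻¹ * x)).hasDerivAt.scomp x h1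
        rw [Complex.real_smul] at h2
        push_cast at h2
        exact (h2.const_mul _).const_mul _
      · exact hasDerivAt_const _ _
    rw [hev.deriv_eq, hder.deriv, hfin x (by linarith), Finset.mul_sum, Finset.mul_sum]
    have hA := count_bound (Finset.range N) (fun j => (x:ℂ) * if (s : ℝ) / ε ≤ (j : ℝ) then
        (1/3) * (((8:ℂ)^j)⁻¹ * Phi ψ (((8:ℝ)^j)⁻¹ * x)) else 0) M x ?_ ?_
    have hB := count_bound (Finset.range N) (fun j => (x:ℂ)^2 * if (s : ℝ) / ε ≤ (j : ℝ) then
        (1/3) * (((8:ℂ)^j)⁻¹ * (((8:ℂ)^j)⁻¹ * deriv (Phi ψ) (((8:ℝ)^j)⁻¹ * x))) else 0) M' x ?_ ?_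
    · linarith
    · intro j
      split_ifs
      · by_cases h0 : deriv (Phi ψ) (((8:ℝ)^j)⁻¹ * x) = 0
        · simp [h0, hM0']
        · have h1 := (hDs _ h0).2
          have h2 := hM' (((8:ℝ)^j)⁻¹ * x)
          rw [show (x:ℂ)^2 * ((1/3) * (((8:ℂ)^j)⁻¹ * (((8:ℂ)^j)⁻¹ * deriv (Phi ψ) (((8:ℝ)^j)⁻¹ * x))))
            = (1/3) * (((((8:ℝ)^j)⁻¹ * x : ℝ) : ℂ)^2 * deriv (Phi ψ) (((8:ℝ)^j)⁻¹ * x)) by push_cast; ring]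
          rw [norm_mul, norm_mul, norm_pow, Complex.norm_real, Real.norm_eq_abs]
          have h3 : ‖(1/3:ℂ)‖ ≤ 1 := by norm_num
          calc _ ≤ 1 * (1^2 * M') := by gcongr
            _ = M' := by ring
      · simpa using hM0'
    · intro j hj
      apply hDs
      intro h
      apply hj
      simp [h]
    · intro j
      split_ifs
      · by_cases h0 : Phi ψ (((8:ℝ)^j)⁻¹ * x) = 0
        · simp [h0, hM0]
        · have h1 := (hPs _ h0).2
          have h2 := hM (((8:ℝ)^j)⁻¹ * x)
          rw [show (x:ℂ) * ((1/3) * (((8:ℂ)^j)⁻¹ * Phi ψ (((8:ℝ)^j)⁻¹ * x)))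
            = (1/3) * (((((8:ℝ)^j)⁻¹ * x : ℝ) : ℂ) * Phi ψ (((8:ℝ)^j)⁻¹ * x)) by push_cast; ring]
          rw [norm_mul, norm_mul, Complex.norm_real, Real.norm_eq_abs]
          have h3 : ‖(1/3:ℂ)‖ ≤ 1 := by norm_num
          calc _ ≤ 1 * (1 * M) := by gcongr
            _ = M := by ring
      · simpa using hM0
    · intro j hj
      have := hPs (((8:ℝ)^j)⁻¹ * x) (by
        intro h
        apply hj
        simp [h])
      exact ⟨this.1.le, this.2⟩
  · intro x hx
    rw [HsInv_eq ψ hsmooth hodd hsupp]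
    refine (tsum_congr fun j => ?_).trans tsum_zero
    split_ifs with hj
    · have : Phi ψ (((8:ℝ)^j)⁻¹ * x) = 0 := by
        by_contra h
        have h1 := (hPs _ h).1
        rw [abs_mul, abs_of_pos (by positivity), lt_inv_mul_iff₀ (by positivity)] at h1
        have h2 : (2 : ℝ) ^ (3 * ((s : ℝ) / ε - 2)) ≤ 2 ^ (3 * ((j:ℝ) - 2)) :=
          Real.rpow_le_rpow_of_exponent_le (by norm_num) (by linarith)
        have h3 : (2:ℝ) ^ (3 * ((j:ℝ) - 2)) = 8 ^ j * (1/64) := by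
          rw [Real.rpow_mul (by norm_num), Real.rpow_sub (by norm_num)]
          norm_num
          ring
        linarith
      simp [this]
    · rfl
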